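/- Let N be a finite type with at least two elements. An index φ on N satisfies anonymity, monotonicity, and efficiency if and only if φ is the e-index, i.e. φ_i(c) = Σ_{S ⊆ N, i ∈ S} c(S)/|S| for every credit function c on N and every i ∈ N. -/

import Mathlib

/-- A credit function on `N`: assigns a nonnegative worth to each group of
authors, with the empty group getting worth `0`. -/
def IsCredit {N : Type*} [Fintype N] [DecidableEq N] (c : Finset N → ℝ) : Prop :=
  c ∅ = 0 ∧ ∀ S : Finset N, 0 ≤ c S

/-- The e-index: `e_i(c) = Σ_{S ⊆ N, i ∈ S} c(S)/|S|`. -/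
noncomputable def eIndex {N : Type*} [Fintype N] [DecidableEq N]
    (c : Finset N → ℝ) (i : N) : ℝ :=
  ∑ S ∈ Finset.univ.powerset.filter (fun S => i ∈ S), c S / (S.card : ℝ)

/-- The permuted credit function: `(πc)(T) = c(π⁻¹(T))`. -/
def permCredit {N : Type*} [Fintype N] [DecidableEq N]
    (π : Equiv.Perm N) (c : Finset N → ℝ) : Finset N → ℝ :=
  fun T => c (T.image π.symm)

/-- Anonymity: `φ_{π(i)}(πc) = φ_i(c)` for every permutation `π`,
credit function `c`, and author `i`. -/
def Anonymity {N : Type*} [Fintype N] [DecidableEq N]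
    (φ : (Finset N → ℝ) → N → ℝ) : Prop :=
  ∀ π : Equiv.Perm N, ∀ c : Finset N → ℝ, IsCredit c →
    ∀ i : N, φ (permCredit π c) (π i) = φ c i

/-- Monotonicity: if `c(S ∪ {i}) ≥ d(S ∪ {i})` for all `S ⊆ N \ {i}`,
then `φ_i(c) ≥ φ_i(d)`. -/
def Monotonicity {N : Type*} [Fintype N] [DecidableEq N]
    (φ : (Finset N → ℝ) → N → ℝ) : Prop :=
  ∀ c d : Finset N → ℝ, IsCredit c → IsCredit d → ∀ i : N,
    (∀ S : Finset N, i ∉ S → d (insert i S) ≤ c (insert i S)) →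
    φ d i ≤ φ c i

/-- Efficiency: `Σ_{i ∈ N} φ_i(c) = Σ_{S ⊆ N, S nonempty} c(S)`. -/
def Efficiency {N : Type*} [Fintype N] [DecidableEq N]
    (φ : (Finset N → ℝ) → N → ℝ) : Prop :=
  ∀ c : Finset N → ℝ, IsCredit c →
    ∑ i : N, φ c i = ∑ S ∈ Finset.univ.powerset.filter (fun S => S.Nonempty), c S

theorem Finset.image_swap_eq_self {N : Type*} [DecidableEq N] {S : Finset N} {i j : N}
    (hi : i ∈ S) (hj : j ∈ S) : S.image (Equiv.swap i j) = S := by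
  refine Finset.eq_of_subset_of_card_le (Finset.image_subset_iff.2 fun x hx => ?_)
    (Finset.card_image_of_injective _ (Equiv.swap i j).injective).ge
  rw [Equiv.swap_apply_def]
  split_ifs <;> assumption

section EIndex

variable {N : Type*} [Fintype N] [DecidableEq N]

theorem IsCredit.permCredit {c : Finset N → ℝ} (hc : IsCredit c) (π : Equiv.Perm N) :
    IsCredit (permCredit π c) :=
  ⟨by simpa [_root_.permCredit] using hc.1, fun _ => hc.2 _⟩

/-- Discarding the worth of one group yields a credit function. -/
theorem IsCredit.update_zero {c : Finset N → ℝ} (hc : IsCredit c) (S : Finset N) :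
    IsCredit (Function.update c S 0) := by
  refine ⟨?_, fun T => ?_⟩
  · by_cases h : ∅ = S
    · subst h; simp
    · rw [Function.update_of_ne h, hc.1]
  · by_cases h : T = S
    · subst h; simp
    · rw [Function.update_of_ne h]
      exact hc.2 T

theorem eIndex_congr {c d : Finset N → ℝ} {i : N} (h : ∀ S, i ∈ S → c S = d S) :
    eIndex c i = eIndex d i :=
  Finset.sum_congr rfl fun S hS => by rw [h S (Finset.mem_filter.1 hS).2]

theorem anonymity_eIndex : Anonymity (eIndex (N := N)) := by
  intro π c _ i
  refine Finset.sum_bij' (fun S _ => S.image π.symm) (fun S _ => S.image π) ?_ ?_ ?_ ?_ ?_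
  · intro S hS
    simp only [Finset.mem_filter, Finset.powerset_univ, Finset.mem_univ, true_and] at hS ⊢
    exact Finset.mem_image.2 ⟨π i, hS, by simp⟩
  · intro S hS
    simp only [Finset.mem_filter, Finset.powerset_univ, Finset.mem_univ, true_and] at hS ⊢
    exact Finset.mem_image_of_mem π hS
  · intro S _
    simp [Finset.image_image]
  · intro S _
    simp [Finset.image_image]
  · intro S _
    rw [Finset.card_image_of_injective _ π.symm.injective, permCredit]

theorem monotonicity_eIndex : Monotonicity (eIndex (N := N)) := by
  intro c d _ _ i h
  refine Finset.sum_le_sum fun S hS => ?_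
  have hle := h (S.erase i) (Finset.notMem_erase i S)
  rw [Finset.insert_erase (Finset.mem_filter.1 hS).2] at hle
  gcongr

theorem efficiency_eIndex : Efficiency (eIndex (N := N)) := by
  intro c hc
  simp only [eIndex, Finset.sum_filter]
  rw [Finset.sum_comm]
  refine Finset.sum_congr rfl fun S _ => ?_
  rw [← Finset.sum_filter, Finset.sum_const, Finset.filter_univ_mem, nsmul_eq_mul]
  rcases S.eq_empty_or_nonempty with rfl | hS
  · simp
  · have : (S.card : ℝ) ≠ 0 := by exact_mod_cast hS.card_pos.ne'
    rw [if_pos hS, mul_div_cancel₀ _ this]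

/-- A monotonic index gives `i` a value depending only on the groups containing `i`. -/
theorem Monotonicity.congr {φ : (Finset N → ℝ) → N → ℝ} (hφ : Monotonicity φ)
    {c d : Finset N → ℝ} (hc : IsCredit c) (hd : IsCredit d) {i : N}
    (h : ∀ S, i ∈ S → c S = d S) : φ c i = φ d i :=
  le_antisymm (hφ d c hd hc i fun S _ => (h _ (Finset.mem_insert_self i S)).le)
    (hφ c d hc hd i fun S _ => (h _ (Finset.mem_insert_self i S)).ge)

/-- Swapping two authors who belong to every group of nonzero worth changes nothing. -/
theorem permCredit_swap {c : Finset N → ℝ} {i j : N} (hi : ∀ S, c S ≠ 0 → i ∈ S)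
    (hj : ∀ S, c S ≠ 0 → j ∈ S) : permCredit (Equiv.swap i j) c = c := by
  funext S
  rw [permCredit, Equiv.symm_swap]
  by_cases hS : c S = 0
  · by_contra hne
    have hT : c (S.image (Equiv.swap i j)) ≠ 0 := fun h => hne (h.trans hS.symm)
    have hfix := Finset.image_swap_eq_self (hi _ hT) (hj _ hT)
    rw [Finset.image_image, ← Equiv.coe_trans, Equiv.swap_swap, Equiv.coe_refl,
      Finset.image_id] at hfix
    exact hne (congrArg c hfix.symm)
  · rw [Finset.image_swap_eq_self (hi S hS) (hj S hS)]

theorem Anonymity.eq_of_forall_mem {φ : (Finset N → ℝ) → N → ℝ} (hφ : Anonymity φ)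
    {c : Finset N → ℝ} (hc : IsCredit c) {i j : N} (hi : ∀ S, c S ≠ 0 → i ∈ S)
    (hj : ∀ S, c S ≠ 0 → j ∈ S) : φ c i = φ c j := by
  have h := hφ (Equiv.swap i j) c hc i
  rw [permCredit_swap hi hj, Equiv.swap_apply_left] at h
  exact h.symm

/-- By induction on the number of groups of nonzero worth. -/
theorem eq_eIndex {φ : (Finset N → ℝ) → N → ℝ} (hanon : Anonymity φ) (hmono : Monotonicity φ)
    (heff : Efficiency φ) (c : Finset N → ℝ) (hc : IsCredit c) (i : N) :
    φ c i = eIndex c i := by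
  induction hn : (Finset.univ.filter fun S => c S ≠ 0).card using Nat.strong_induction_on
    generalizing c i with
  | _ n ih =>
  have outside : ∀ k, (¬ ∀ S, c S ≠ 0 → k ∈ S) → φ c k = eIndex c k := by
    intro k hk
    push Not at hk
    obtain ⟨S, hS, hkS⟩ := hk
    have hagree : ∀ T, k ∈ T → c T = Function.update c S 0 T := fun T hT =>
      (Function.update_of_ne (ne_of_mem_of_not_mem' hT hkS) _ _).symm
    rw [hmono.congr hc (hc.update_zero S) hagree, eIndex_congr hagree]
    refine ih _ ?_ _ (hc.update_zero S) k rfl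
    rw [← hn]
    refine Finset.card_lt_card
      ((Finset.ssubset_iff_of_subset ?_).2 ⟨S, by simpa using hS, by simp⟩)
    intro T hT
    simp only [Finset.mem_filter, Finset.mem_univ, true_and] at hT ⊢
    by_cases h : T = S
    · rwa [h]
    · rwa [Function.update_of_ne h] at hT
  by_cases hi : ∀ S, c S ≠ 0 → i ∈ S
  · have hsum : ∑ k, (φ c k - eIndex c k) * (φ c i - eIndex c i) = 0 := by
      rw [← Finset.sum_mul, Finset.sum_sub_distrib, heff c hc, efficiency_eIndex c hc, sub_self,
        zero_mul]
    have hnonneg : ∀ k ∈ Finset.univ, 0 ≤ (φ c k - eIndex c k) * (φ c i - eIndex c i) := by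
      intro k _
      by_cases hk : ∀ S, c S ≠ 0 → k ∈ S
      · rw [hanon.eq_of_forall_mem hc hk hi, anonymity_eIndex.eq_of_forall_mem hc hk hi]
        exact mul_self_nonneg _
      · simp [outside k hk]
    exact sub_eq_zero.1 (mul_self_eq_zero.1
      ((Finset.sum_eq_zero_iff_of_nonneg hnonneg).1 hsum i (Finset.mem_univ i)))
  · exact outside i hi

end EIndex

/-- Main theorem: an index satisfies anonymity, monotonicity and efficiency if
and only if it is the e-index. -/
theorem index_characterization {N : Type*} [Fintype N] [DecidableEq N] [Nontrivial N]
    (φ : (Finset N → ℝ) → N → ℝ) :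
    (Anonymity φ ∧ Monotonicity φ ∧ Efficiency φ) ↔
      (∀ c : Finset N → ℝ, IsCredit c → ∀ i : N, φ c i = eIndex c i) := by
  refine ⟨fun ⟨hanon, hmono, heff⟩ => eq_eIndex hanon hmono heff, fun h => ⟨?_, ?_, ?_⟩⟩
  · intro π c hc i
    rw [h _ (hc.permCredit π), h c hc, anonymity_eIndex π c hc i]
  · intro c d hc hd i hle
    rw [h c hc, h d hd]
    exact monotonicity_eIndex c d hc hd i hle
  · intro c hc
    simp only [h c hc]
    exact efficiency_eIndex c hc
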